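/- Consider a finite Markov decision process with state set S, action set A, transition probabilities p, cost c and discount γ ∈ (0,1). Let Q* : S × A → ℝ satisfy T Q* = Q*, let π* : S → A be greedy with respect to Q*, let Q_K : S × A → ℝ be arbitrary, let π_K : S → A be greedy with respect to Q_K, and let Q^{π_K} : S × A → ℝ satisfy T^{π_K} Q^{π_K} = Q^{π_K}. Then pointwise on S × A: Q^{π_K} − Q* ≤ γ · Σ_{m=0}^{∞} γ^m (P^{π_K})^m [ (P^{π_K} − P^{π*})(Q* − Q_K) ], where the series on the right-hand side converges. -/

import Mathlib

open Finset

/-- The transition operator `P^π` of a deterministic policy `π` in a finite MDP: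
`(P^π f)(s,a) = Σ_{s'} p(s,a,s') f(s', π(s'))`. -/
noncomputable def Pop {S A : Type*} [Fintype S]
    (p : S → A → S → ℝ) (π : S → A) (f : S → A → ℝ) : S → A → ℝ :=
  fun s a => ∑ s', p s a s' * f s' (π s')

/-- The Bellman evaluation operator of a policy `π`:
`(T^π f)(s,a) = c(s,a) + γ (P^π f)(s,a)`. -/
noncomputable def bellmanEval {S A : Type*} [Fintype S]
    (p : S → A → S → ℝ) (c : S → A → ℝ) (γ : ℝ) (π : S → A)
    (f : S → A → ℝ) : S → A → ℝ :=
  fun s a => c s a + γ * Pop p π f s a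

/-- The Bellman optimality operator:
`(T f)(s,a) = c(s,a) + γ Σ_{s'} p(s,a,s') min_{a'} f(s',a')`. -/
noncomputable def bellmanOpt {S A : Type*} [Fintype S] [Fintype A] [Nonempty A]
    (p : S → A → S → ℝ) (c : S → A → ℝ) (γ : ℝ) (f : S → A → ℝ) : S → A → ℝ :=
  fun s a => c s a + γ * ∑ s', p s a s' * (univ.inf' univ_nonempty (f s'))

section TransitionOperator

variable {S A : Type*} [Fintype S] {p : S → A → S → ℝ}

theorem Pop_mono (hp : ∀ s a s', 0 ≤ p s a s') (π : S → A) : Monotone (Pop p π) :=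
  fun _ _ hfg s a => sum_le_sum fun s' _ => mul_le_mul_of_nonneg_left (hfg s' (π s')) (hp s a s')

theorem Pop_sub (π : S → A) (f g : S → A → ℝ) : Pop p π (f - g) = Pop p π f - Pop p π g := by
  ext s a
  simp [Pop, mul_sub, sum_sub_distrib]

theorem Pop_smul_add (π : S → A) (r : ℝ) (f g : S → A → ℝ) :
    Pop p π (r • (f + g)) = r • (Pop p π f + Pop p π g) := by
  ext s a
  simp only [Pop, Pi.smul_apply, Pi.add_apply, smul_eq_mul, ← sum_add_distrib, mul_sum]
  exact sum_congr rfl fun _ _ => by ring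

theorem Pop_iterate_smul_add (π : S → A) (r : ℝ) (f g : S → A → ℝ) (n : ℕ) :
    (Pop p π)^[n] (r • (f + g)) = r • ((Pop p π)^[n] f + (Pop p π)^[n] g) := by
  induction n with
  | zero => rfl
  | succ n ih => simp only [Function.iterate_succ_apply', ih, Pop_smul_add]

theorem abs_Pop_le (hp : ∀ s a s', 0 ≤ p s a s') (hpsum : ∀ s a, ∑ s', p s a s' = 1)
    (π : S → A) {f : S → A → ℝ} {C : ℝ} (hf : ∀ s a, |f s a| ≤ C) (s : S) (a : A) :
    |Pop p π f s a| ≤ C :=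
  calc |Pop p π f s a| ≤ ∑ s', |p s a s' * f s' (π s')| := abs_sum_le_sum_abs _ _
    _ ≤ ∑ s', p s a s' * C := sum_le_sum fun s' _ => by
        rw [abs_mul, abs_of_nonneg (hp s a s')]
        exact mul_le_mul_of_nonneg_left (hf _ _) (hp s a s')
    _ = C := by rw [← sum_mul, hpsum, one_mul]

theorem abs_Pop_iterate_le (hp : ∀ s a s', 0 ≤ p s a s') (hpsum : ∀ s a, ∑ s', p s a s' = 1)
    (π : S → A) {f : S → A → ℝ} {C : ℝ} (hf : ∀ s a, |f s a| ≤ C) (n : ℕ) (s : S) (a : A) :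
    |(Pop p π)^[n] f s a| ≤ C := by
  induction n generalizing s a with
  | zero => exact hf s a
  | succ n ih =>
    rw [Function.iterate_succ_apply']
    exact abs_Pop_le hp hpsum π ih s a

theorem summable_geometric_mul_Pop_iterate [Finite A] (hp : ∀ s a s', 0 ≤ p s a s')
    (hpsum : ∀ s a, ∑ s', p s a s' = 1) {γ : ℝ} (h₀ : 0 ≤ γ) (h₁ : γ < 1)
    (π : S → A) (f : S → A → ℝ) (s : S) (a : A) :
    Summable fun m : ℕ => γ ^ m * (Pop p π)^[m] f s a := by
  obtain ⟨C, hC⟩ := (Set.finite_range fun x : S × A => |f x.1 x.2|).bddAbove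
  have hf : ∀ s a, |f s a| ≤ C := fun s a => hC ⟨(s, a), rfl⟩
  refine .of_norm_bounded ((summable_geometric_of_lt_one h₀ h₁).mul_right C) fun m => ?_
  rw [Real.norm_eq_abs, abs_mul, abs_of_nonneg (pow_nonneg h₀ m)]
  exact mul_le_mul_of_nonneg_left (abs_Pop_iterate_le hp hpsum π hf m s a) (pow_nonneg h₀ m)

theorem le_sum_range_add_Pop_iterate (hp : ∀ s a s', 0 ≤ p s a s') {γ : ℝ} (h₀ : 0 ≤ γ)
    (π : S → A) {f h : S → A → ℝ} (hf : f ≤ γ • (h + Pop p π f)) (n : ℕ) (s : S) (a : A) :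
    f s a ≤ γ * ∑ m ∈ range n, γ ^ m * (Pop p π)^[m] h s a + γ ^ n * (Pop p π)^[n] f s a := by
  induction n with
  | zero => simp
  | succ n ih =>
    have hstep := (Pop_mono hp π).iterate n hf s a
    rw [Pop_iterate_smul_add, ← Function.iterate_succ_apply] at hstep
    simp only [Pi.smul_apply, Pi.add_apply, smul_eq_mul] at hstep
    have := mul_le_mul_of_nonneg_left hstep (pow_nonneg h₀ n)
    rw [sum_range_succ, pow_succ]
    linarith

/-- Comparison principle for the monotone Neumann resolvent `(I - γ P^π)⁻¹`. -/
theorem le_tsum_Pop_iterate_of_le [Finite A] (hp : ∀ s a s', 0 ≤ p s a s')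
    (hpsum : ∀ s a, ∑ s', p s a s' = 1) {γ : ℝ} (h₀ : 0 ≤ γ) (h₁ : γ < 1)
    (π : S → A) {f h : S → A → ℝ} (hf : f ≤ γ • (h + Pop p π f)) (s : S) (a : A) :
    f s a ≤ γ * ∑' m : ℕ, γ ^ m * (Pop p π)^[m] h s a := by
  have hsum := summable_geometric_mul_Pop_iterate hp hpsum h₀ h₁ π h s a
  have hrem := (summable_geometric_mul_Pop_iterate hp hpsum h₀ h₁ π f s a).tendsto_atTop_zero
  have hlim := (hsum.hasSum.tendsto_sum_nat.const_mul γ).add hrem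
  rw [add_zero] at hlim
  exact ge_of_tendsto' hlim fun n => le_sum_range_add_Pop_iterate hp h₀ π hf n s a

theorem Pop_le_Pop_of_greedy [Fintype A] [Nonempty A] (hp : ∀ s a s', 0 ≤ p s a s')
    {f : S → A → ℝ} {π : S → A} (hπ : ∀ s, f s (π s) = univ.inf' univ_nonempty (f s))
    (π' : S → A) : Pop p π f ≤ Pop p π' f := fun s a =>
  sum_le_sum fun s' _ => mul_le_mul_of_nonneg_left
    ((hπ s').trans_le (inf'_le _ (mem_univ _))) (hp s a s')

theorem bellmanOpt_eq_bellmanEval_of_greedy [Fintype A] [Nonempty A] (c : S → A → ℝ) (γ : ℝ)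
    {f : S → A → ℝ} {π : S → A} (hπ : ∀ s, f s (π s) = univ.inf' univ_nonempty (f s)) :
    bellmanOpt p c γ f = bellmanEval p c γ π f := by
  ext s a
  simp only [bellmanOpt, bellmanEval, Pop, ← hπ]

end TransitionOperator

/-- **Step 3 of the FQI error-propagation analysis**: suboptimality of the greedy
policy `π_K` against the fitting error, via the monotone Neumann resolvent.
Pointwise on `S × A`,
`Q^{π_K} − Q* ≤ γ Σ_{m≥0} γ^m (P^{π_K})^m [(P^{π_K} − P^{π*})(Q* − Q_K)]`,
and the series converges. -/
theorem fqi_greedy_policy_suboptimality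
    {S A : Type*} [Fintype S] [Fintype A] [Nonempty S] [Nonempty A]
    (p : S → A → S → ℝ) (hp : ∀ s a s', 0 ≤ p s a s')
    (hpsum : ∀ s a, ∑ s', p s a s' = 1)
    (c : S → A → ℝ) (γ : ℝ) (hγ : γ ∈ Set.Ioo (0 : ℝ) 1)
    (Qstar : S → A → ℝ) (hQstar : bellmanOpt p c γ Qstar = Qstar)
    (πstar : S → A)
    (hgreedyStar : ∀ s, Qstar s (πstar s) = univ.inf' univ_nonempty (Qstar s))
    (QK : S → A → ℝ) (πK : S → A)
    (hgreedyK : ∀ s, QK s (πK s) = univ.inf' univ_nonempty (QK s))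
    (QpiK : S → A → ℝ) (hQpiK : bellmanEval p c γ πK QpiK = QpiK) :
    (∀ s a, Summable (fun m : ℕ =>
      γ ^ m * ((Pop p πK)^[m]
        (Pop p πK (Qstar - QK) - Pop p πstar (Qstar - QK))) s a)) ∧
    (∀ s a,
      QpiK s a - Qstar s a
        ≤ γ * ∑' m : ℕ,
            γ ^ m * ((Pop p πK)^[m]
              (Pop p πK (Qstar - QK) - Pop p πstar (Qstar - QK))) s a) := by
  refine ⟨summable_geometric_mul_Pop_iterate hp hpsum hγ.1.le hγ.2 πK _,
    le_tsum_Pop_iterate_of_le (f := QpiK - Qstar) hp hpsum hγ.1.le hγ.2 πK fun s a => ?_⟩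
  rw [bellmanOpt_eq_bellmanEval_of_greedy c γ hgreedyStar] at hQstar
  have hstar := congr_fun₂ hQstar s a
  have hK := congr_fun₂ hQpiK s a
  have hgreedy := mul_le_mul_of_nonneg_left (Pop_le_Pop_of_greedy hp hgreedyK πstar s a) hγ.1.le
  simp only [bellmanEval] at hstar hK
  simp only [Pop_sub, Pi.smul_apply, Pi.add_apply, Pi.sub_apply, smul_eq_mul]
  linarith
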